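/- (Converse bounds for two-receiver broadcast channels, El Gamal) For any (n, M_1, M_2, ε)-code over a discrete memoryless broadcast channel P_{Y1,Y2|X}, there exist random variables U_{1i} := (W1, Y1^{i−1}, Y_{2,i+1}^n) and U_{2i} := (W2, Y_{1,i+1}^n, Y2^{i−1}) satisfying (U_{1i}, U_{2i}) → X_i → (Y_{1i}, Y_{2i}) such that: (log M_1)(1−ε) − 1 ≤ ∑_{i=1}^n I(U_{1i}; Y_{1i}), (log M_2)(1−ε) − 1 ≤ ∑_{i=1}^n I(U_{2i}; Y_{2i}), and (log M_1 + log M_2)(1−ε) − 2 ≤ ∑_{i=1}^n [I(X_i; Y_{1i} | U_{2i}) + I(U_{2i}; Y_{2i})]. -/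

import Mathlib

open Finset
open scoped Classical

/-- Distribution of the random variable `A` under the pmf `μ` on a finite sample
space `Ω`. -/
noncomputable def distOf {Ω α : Type*} [Fintype Ω] [Fintype α] [DecidableEq α]
    (μ : Ω → ℝ) (A : Ω → α) : α → ℝ :=
  fun a => ∑ ω ∈ univ.filter (fun ω => A ω = a), μ ω

/-- Mutual information `I(A;B)` of the random variables `A, B` under the pmf `μ`. -/
noncomputable def MI {Ω α β : Type*} [Fintype Ω] [Fintype α] [Fintype β]
    [DecidableEq α] [DecidableEq β] (μ : Ω → ℝ) (A : Ω → α) (B : Ω → β) : ℝ :=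
  ∑ a, ∑ b, distOf μ (fun ω => (A ω, B ω)) (a, b) *
    Real.log (distOf μ (fun ω => (A ω, B ω)) (a, b) /
      (distOf μ A a * distOf μ B b))

/-- Conditional mutual information `I(A;B|C)` under the pmf `μ`. -/
noncomputable def CMI {Ω α β γ : Type*} [Fintype Ω] [Fintype α] [Fintype β] [Fintype γ]
    [DecidableEq α] [DecidableEq β] [DecidableEq γ]
    (μ : Ω → ℝ) (A : Ω → α) (B : Ω → β) (C : Ω → γ) : ℝ :=
  ∑ a, ∑ b, ∑ c, distOf μ (fun ω => (A ω, B ω, C ω)) (a, b, c) *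
    Real.log (distOf μ (fun ω => (A ω, B ω, C ω)) (a, b, c) * distOf μ C c /
      (distOf μ (fun ω => (A ω, C ω)) (a, c) * distOf μ (fun ω => (B ω, C ω)) (b, c)))

section helpers
variable {Ω α β γ : Type*} [Fintype Ω]

/-- probability of the atom of `A` containing `ω` -/
noncomputable def bcPr (μ : Ω → ℝ) (A : Ω → α) (ω : Ω) : ℝ :=
  ∑ ω', if A ω' = A ω then μ ω' else 0

/-- entropy -/
noncomputable def bcH (μ : Ω → ℝ) (A : Ω → α) : ℝ :=
  -∑ ω, μ ω * Real.log (bcPr μ A ω)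

theorem bcPr_eq [Fintype α] [DecidableEq α] (μ : Ω → ℝ) (A : Ω → α) (ω : Ω) :
    bcPr μ A ω = distOf μ A (A ω) := by
  unfold bcPr distOf
  rw [Finset.sum_filter]
  refine Finset.sum_congr rfl fun x _ => ?_
  by_cases h : A x = A ω <;> simp [h]

theorem bcH_congr (μ : Ω → ℝ) (A : Ω → α) (B : Ω → β)
    (h : ∀ ω ω', A ω = A ω' ↔ B ω = B ω') : bcH μ A = bcH μ B := by
  have : ∀ ω, bcPr μ A ω = bcPr μ B ω := fun ω => by
    unfold bcPr
    exact Finset.sum_congr rfl fun x _ => by simp [h]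
  simp [bcH, this]

theorem bcPr_pos {μ : Ω → ℝ} (h0 : ∀ ω, 0 ≤ μ ω) (A : Ω → α) {ω : Ω} (h : 0 < μ ω) :
    0 < bcPr μ A ω := by
  have : μ ω ≤ bcPr μ A ω := by
    unfold bcPr
    have := Finset.single_le_sum (f := fun ω' => if A ω' = A ω then μ ω' else 0)
      (fun i _ => by split_ifs <;> simp [h0]) (Finset.mem_univ ω)
    simpa using this
  linarith

theorem distOf_nonneg {μ : Ω → ℝ} (h0 : ∀ ω, 0 ≤ μ ω) [Fintype α] [DecidableEq α]
    (A : Ω → α) (a : α) : 0 ≤ distOf μ A a :=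
  Finset.sum_nonneg fun i _ => h0 i

theorem sum_distOf_mul [Fintype α] [DecidableEq α] (μ : Ω → ℝ) (A : Ω → α) (F : α → ℝ) :
    ∑ a, distOf μ A a * F a = ∑ ω, μ ω * F (A ω) := by
  rw [← Finset.sum_fiberwise (s := univ) (g := A)]
  refine Finset.sum_congr rfl fun a _ => ?_
  unfold distOf
  rw [Finset.sum_mul]
  refine Finset.sum_congr rfl fun x hx => ?_
  simp at hx
  rw [hx]

theorem distOf_marg [Fintype α] [DecidableEq α] [Fintype β] [DecidableEq β]
    (μ : Ω → ℝ) (A : Ω → α) (B : Ω → β) (b : β) :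
    ∑ a, distOf μ (fun ω => (A ω, B ω)) (a, b) = distOf μ B b := by
  unfold distOf
  rw [← Finset.sum_fiberwise (s := univ.filter (fun ω => B ω = b)) (g := A)]
  refine Finset.sum_congr rfl fun a _ => ?_
  rw [Finset.filter_filter]
  refine Finset.sum_congr ?_ fun _ _ => rfl
  ext x; simp [and_comm]

theorem sum_distOf [Fintype α] [DecidableEq α] (μ : Ω → ℝ) (A : Ω → α) :
    ∑ a, distOf μ A a = ∑ ω, μ ω := by
  simpa using sum_distOf_mul μ A (fun _ => 1)

theorem MI_eq [Fintype α] [DecidableEq α] [Fintype β] [DecidableEq β] {μ : Ω → ℝ}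
    (h0 : ∀ ω, 0 ≤ μ ω) (A : Ω → α) (B : Ω → β) :
    MI μ A B = bcH μ A + bcH μ B - bcH μ (fun ω => (A ω, B ω)) := by
  unfold MI
  rw [← Fintype.sum_prod_type' (f := fun a b => distOf μ (fun ω => (A ω, B ω)) (a, b) *
    Real.log (distOf μ (fun ω => (A ω, B ω)) (a, b) /
      (distOf μ A a * distOf μ B b)))]
  rw [sum_distOf_mul μ (fun ω => (A ω, B ω)) (fun x => Real.log (distOf μ (fun ω => (A ω, B ω)) (x.1, x.2) /
      (distOf μ A x.1 * distOf μ B x.2)))]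
  unfold bcH
  rw [sub_neg_eq_add, ← neg_add, ← Finset.sum_add_distrib, ← Finset.sum_neg_distrib,
    ← Finset.sum_add_distrib]
  refine Finset.sum_congr rfl fun ω _ => ?_
  rcases (h0 ω).eq_or_lt with h | h
  · simp [← h]
  have h1 := bcPr_pos h0 A h
  have h2 := bcPr_pos h0 B h
  have h3 := bcPr_pos h0 (fun ω => (A ω, B ω)) h
  rw [bcPr_eq] at *
  rw [bcPr_eq] at *
  rw [bcPr_eq] at *
  rw [Real.log_div h3.ne' (mul_pos h1 h2).ne', Real.log_mul h1.ne' h2.ne']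
  ring

theorem CMI_eq [Fintype α] [DecidableEq α] [Fintype β] [DecidableEq β]
    [Fintype γ] [DecidableEq γ] {μ : Ω → ℝ}
    (h0 : ∀ ω, 0 ≤ μ ω) (A : Ω → α) (B : Ω → β) (C : Ω → γ) :
    CMI μ A B C = bcH μ (fun ω => (A ω, C ω)) + bcH μ (fun ω => (B ω, C ω))
      - bcH μ (fun ω => (A ω, B ω, C ω)) - bcH μ C := by
  unfold CMI
  have e := sum_distOf_mul μ (fun ω => (A ω, B ω, C ω)) (fun x => Real.log
    (distOf μ (fun ω => (A ω, B ω, C ω)) (x.1, x.2.1, x.2.2) * distOf μ C x.2.2 /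
      (distOf μ (fun ω => (A ω, C ω)) (x.1, x.2.2) *
        distOf μ (fun ω => (B ω, C ω)) (x.2.1, x.2.2))))
  simp only [Fintype.sum_prod_type] at e
  rw [e]
  unfold bcH
  rw [sub_neg_eq_add, sub_neg_eq_add, ← neg_add, ← Finset.sum_add_distrib,
    ← Finset.sum_neg_distrib, ← Finset.sum_add_distrib, ← Finset.sum_add_distrib]
  refine Finset.sum_congr rfl fun ω _ => ?_
  rcases (h0 ω).eq_or_lt with h | h
  · simp [← h]
  have h1 := bcPr_pos h0 (fun ω => (A ω, C ω)) h
  have h2 := bcPr_pos h0 (fun ω => (B ω, C ω)) h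
  have h3 := bcPr_pos h0 (fun ω => (A ω, B ω, C ω)) h
  have h4 := bcPr_pos h0 C h
  simp only [bcPr_eq] at *
  rw [Real.log_div (mul_pos h3 h4).ne' (mul_pos h1 h2).ne', Real.log_mul h1.ne' h2.ne',
    Real.log_mul h3.ne' h4.ne']
  ring

theorem bc_gibbs [Fintype α] {μ : Ω → ℝ}
    (h0 : ∀ ω, 0 ≤ μ ω) (h1 : ∑ ω, μ ω = 1) (A : Ω → α) (g : α → ℝ) (hg : ∀ a, 0 ≤ g a)
    (hs : ∑ a, g a ≤ 1) (hp : ∀ ω, 0 < μ ω → 0 < g (A ω)) :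
    bcH μ A ≤ -∑ ω, μ ω * Real.log (g (A ω)) := by
  have k1 : ∑ ω, μ ω * Real.log (g (A ω)) - ∑ ω, μ ω * Real.log (bcPr μ A ω) ≤
      ∑ ω, μ ω * (g (A ω) / distOf μ A (A ω)) - ∑ ω, μ ω := by
    rw [← Finset.sum_sub_distrib, ← Finset.sum_sub_distrib]
    refine Finset.sum_le_sum fun ω _ => ?_
    rcases (h0 ω).eq_or_lt with h | h
    · simp [← h]
    have p1 := bcPr_pos h0 A h
    have p2 := hp ω h
    rw [bcPr_eq] at *
    rw [← mul_sub, ← Real.log_div p2.ne' p1.ne']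
    have := Real.log_le_sub_one_of_pos (div_pos p2 p1)
    nlinarith
  have k2 : ∑ ω, μ ω * (g (A ω) / distOf μ A (A ω)) ≤ ∑ a, g a := by
    rw [← sum_distOf_mul μ A (fun a => g a / distOf μ A a)]
    refine Finset.sum_le_sum fun a _ => ?_
    rcases (distOf_nonneg h0 A a).eq_or_lt with h | h
    · simp [← h, hg]
    · rw [mul_div_cancel₀ _ h.ne']
  unfold bcH
  linarith

theorem bc_ssa [Fintype α] [Fintype β] [Fintype γ] {μ : Ω → ℝ}
    (h0 : ∀ ω, 0 ≤ μ ω) (h1 : ∑ ω, μ ω = 1) (A : Ω → α) (B : Ω → β) (C : Ω → γ) :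
    bcH μ (fun ω => (A ω, B ω, C ω)) + bcH μ C ≤
      bcH μ (fun ω => (A ω, C ω)) + bcH μ (fun ω => (B ω, C ω)) := by
  have k := bc_gibbs h0 h1 (fun ω => (A ω, B ω, C ω))
    (fun x => distOf μ (fun ω => (A ω, C ω)) (x.1, x.2.2) *
      distOf μ (fun ω => (B ω, C ω)) (x.2.1, x.2.2) / distOf μ C x.2.2)
    (fun a => div_nonneg (mul_nonneg (distOf_nonneg h0 _ _) (distOf_nonneg h0 _ _))
      (distOf_nonneg h0 _ _)) ?_ ?_
  · have : ∑ ω, μ ω * Real.log (distOf μ (fun ω => (A ω, C ω)) (A ω, C ω) *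
      distOf μ (fun ω => (B ω, C ω)) (B ω, C ω) / distOf μ C (C ω)) =
        -bcH μ (fun ω => (A ω, C ω)) - bcH μ (fun ω => (B ω, C ω)) + bcH μ C := by
      unfold bcH
      rw [neg_neg, sub_neg_eq_add, ← Finset.sum_neg_distrib, ← Finset.sum_add_distrib,
        ← Finset.sum_add_distrib]
      refine Finset.sum_congr rfl fun ω _ => ?_
      rcases (h0 ω).eq_or_lt with h | h
      · simp [← h]
      have h1 := bcPr_pos h0 (fun ω => (A ω, C ω)) h
      have h2 := bcPr_pos h0 (fun ω => (B ω, C ω)) h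
      have h4 := bcPr_pos h0 C h
      simp only [bcPr_eq] at *
      rw [Real.log_div (mul_pos h1 h2).ne' h4.ne', Real.log_mul h1.ne' h2.ne']
      ring
    dsimp only at k
    rw [this] at k
    linarith
  · simp only [Fintype.sum_prod_type]
    have : ∀ a b, ∑ c, distOf μ (fun ω => (A ω, C ω)) (a, c) *
        distOf μ (fun ω => (B ω, C ω)) (b, c) / distOf μ C c =
        ∑ c, distOf μ (fun ω => (A ω, C ω)) (a, c) *
        (distOf μ (fun ω => (B ω, C ω)) (b, c) / distOf μ C c) := fun a b =>
      Finset.sum_congr rfl fun c _ => mul_div_assoc _ _ _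
    simp only [this]
    rw [Finset.sum_congr rfl fun a _ => Finset.sum_comm, Finset.sum_comm]
    simp only [← Finset.mul_sum, ← Finset.sum_mul, ← Finset.sum_div, distOf_marg]
    rw [← h1, ← sum_distOf μ C]
    refine Finset.sum_le_sum fun c _ => ?_
    rcases (distOf_nonneg h0 C c).eq_or_lt with h | h
    · simp [← h]
    · rw [div_self h.ne', mul_one]
  · intro ω h
    have h1 := bcPr_pos h0 (fun ω => (A ω, C ω)) h
    have h2 := bcPr_pos h0 (fun ω => (B ω, C ω)) h
    have h4 := bcPr_pos h0 C h
    simp only [bcPr_eq] at *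
    positivity

/-- submodularity up to relabelling -/
theorem bc_sub [Fintype α] [Fintype β] [Fintype γ] {μ : Ω → ℝ}
    (h0 : ∀ ω, 0 ≤ μ ω) (h1 : ∑ ω, μ ω = 1) (A : Ω → α) (B : Ω → β) (C : Ω → γ)
    {δ₁ δ₂ δ₃ : Type*} (D : Ω → δ₁) (E : Ω → δ₂) (F : Ω → δ₃)
    (hD : ∀ ω ω', D ω = D ω' ↔ (A ω = A ω' ∧ B ω = B ω' ∧ C ω = C ω'))
    (hE : ∀ ω ω', E ω = E ω' ↔ (A ω = A ω' ∧ C ω = C ω'))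
    (hF : ∀ ω ω', F ω = F ω' ↔ (B ω = B ω' ∧ C ω = C ω')) :
    bcH μ D + bcH μ C ≤ bcH μ E + bcH μ F := by
  rw [bcH_congr μ D (fun ω => (A ω, B ω, C ω)) (by simpa using hD),
    bcH_congr μ E (fun ω => (A ω, C ω)) (by simpa using hE),
    bcH_congr μ F (fun ω => (B ω, C ω)) (by simpa using hF)]
  exact bc_ssa h0 h1 A B C

theorem bcH_const {μ : Ω → ℝ} (h1 : ∑ ω, μ ω = 1) (A : Ω → α) (h : ∀ ω ω', A ω = A ω') :
    bcH μ A = 0 := by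
  have : ∀ ω, bcPr μ A ω = 1 := fun ω => by
    unfold bcPr; rw [← h1]
    exact Finset.sum_congr rfl fun x _ => by rw [if_pos (h _ _)]
  simp [bcH, this]

theorem bc_subadd [Fintype α] [Fintype β] {μ : Ω → ℝ}
    (h0 : ∀ ω, 0 ≤ μ ω) (h1 : ∑ ω, μ ω = 1) (A : Ω → α) (B : Ω → β)
    {δ₁ : Type*} (D : Ω → δ₁)
    (hD : ∀ ω ω', D ω = D ω' ↔ (A ω = A ω' ∧ B ω = B ω')) :
    bcH μ D ≤ bcH μ A + bcH μ B := by
  have := bc_sub h0 h1 A B (fun _ => ()) D A B (by simpa using hD) (by simp) (by simp)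
  rw [bcH_const h1 (fun _ => ()) (by simp)] at this
  linarith

theorem bc_fano [Fintype α] {M : ℕ} (hM : 0 < M) {μ : Ω → ℝ}
    (h0 : ∀ ω, 0 ≤ μ ω) (h1 : ∑ ω, μ ω = 1) (W : Ω → Fin M) (Y : Ω → α) (φ : α → Fin M)
    (ε : ℝ) (he : ∑ ω ∈ univ.filter (fun ω => φ (Y ω) ≠ W ω), μ ω ≤ ε) :
    bcH μ (fun ω => (W ω, Y ω)) - bcH μ Y ≤ 1 + ε * Real.log M := by
  have hM' : (0:ℝ) < M := by exact_mod_cast hM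
  have k := bc_gibbs h0 h1 (fun ω => (W ω, Y ω))
    (fun x => ((if φ x.2 = x.1 then 1/2 else 0) + 1 / (2 * M)) * distOf μ Y x.2)
    (fun a => mul_nonneg (by positivity) (distOf_nonneg h0 _ _)) ?_ ?_
  · have : ∑ ω, μ ω * (Real.log (distOf μ Y (Y ω)) - Real.log 2 -
        (if φ (Y ω) ≠ W ω then Real.log M else 0)) ≤
        ∑ ω, μ ω * Real.log (((if φ (Y ω) = W ω then 1/2 else 0) + 1 / (2 * M)) *
          distOf μ Y (Y ω)) := by
      refine Finset.sum_le_sum fun ω _ => ?_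
      rcases (h0 ω).eq_or_lt with h | h
      · simp [← h]
      have h4 := bcPr_pos h0 Y h
      rw [bcPr_eq] at h4
      refine mul_le_mul_of_nonneg_left ?_ h.le
      rw [Real.log_mul (by positivity) h4.ne']
      by_cases hc : φ (Y ω) = W ω
      · simp only [hc, ne_eq, not_true_eq_false, if_false, if_true]
        have : Real.log (1/2) ≤ Real.log (1/2 + 1/(2*M)) :=
          Real.log_le_log (by norm_num) (by have : (0:ℝ) < 1/(2*M) := by positivity
                                            linarith)
        rw [Real.log_div (by norm_num) (by norm_num), Real.log_one] at this
        linarith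
      · simp only [hc, ne_eq, not_false_eq_true, if_false, if_true, zero_add]
        rw [Real.log_div (by norm_num) (by positivity), Real.log_one,
          Real.log_mul (by norm_num) hM'.ne']
        linarith
    simp only [mul_sub, Finset.sum_sub_distrib, ← Finset.sum_mul, h1] at this
    have e3 : ∑ ω, μ ω * (if φ (Y ω) ≠ W ω then Real.log M else 0) =
        (∑ ω ∈ univ.filter (fun ω => φ (Y ω) ≠ W ω), μ ω) * Real.log M := by
      rw [Finset.sum_filter, Finset.sum_mul]
      exact Finset.sum_congr rfl fun x _ => by split_ifs <;> simp
    rw [e3] at this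
    have hl : 0 ≤ Real.log M := Real.log_natCast_nonneg M
    have h5 := mul_le_mul_of_nonneg_right he hl
    have h6 : Real.log 2 ≤ 1 := by have := Real.log_two_lt_d9; linarith
    have h7 : bcH μ Y = -∑ ω, μ ω * Real.log (distOf μ Y (Y ω)) := by
      simp [bcH, bcPr_eq]
    dsimp only at k
    linarith
  · simp only [Fintype.sum_prod_type]
    rw [Finset.sum_comm]
    simp only [← Finset.sum_mul, Finset.sum_add_distrib, Finset.sum_ite_eq, Finset.sum_const,
      Finset.card_univ, Fintype.card_fin, Finset.mem_univ, if_true, nsmul_eq_mul]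
    have : (1/2 : ℝ) + M * (1 / (2 * M)) = 1 := by field_simp; norm_num
    rw [this]; simp only [one_mul]
    rw [sum_distOf, h1]
  · intro ω h
    have h4 := bcPr_pos h0 Y h
    rw [bcPr_eq] at h4
    refine mul_pos (by positivity) h4

theorem bc_unif [Fintype α] [DecidableEq α] {μ : Ω → ℝ} (h1 : ∑ ω, μ ω = 1) (W : Ω → α)
    (h : ∀ a, distOf μ W a = 1 / (Fintype.card α : ℝ)) :
    bcH μ W = Real.log (Fintype.card α) := by
  simp [bcH, bcPr_eq, h, ← Finset.sum_mul, h1]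

/-- channel factorization -/
theorem bc_chan {R Y X : Type*} [Fintype R] [Fintype Y] [DecidableEq Y] [Fintype α] [DecidableEq α]
    (e : Ω ≃ R × Y) (μ : Ω → ℝ) (ν : R → ℝ) (K : X → Y → ℝ) (hK : ∀ x, ∑ y, K x y = 1)
    (g : R → X) (hμ : ∀ ω, μ ω = ν (e ω).1 * K (g (e ω).1) (e ω).2)
    (A : Ω → α) (a : R → α) (hA : ∀ ω, A ω = a (e ω).1) (g' : α → X) (hg : ∀ r, g r = g' (a r))
    (Z : Ω → Y) (hZ : ∀ ω, Z ω = (e ω).2)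
    (x : α) (y : Y) :
    distOf μ (fun ω => (A ω, Z ω)) (x, y) = distOf μ A x * K (g' x) y := by
  unfold distOf
  simp only [Finset.sum_filter, hA, hμ, hZ]
  rw [Equiv.sum_comp e (fun p => if (a p.1, p.2) = (x, y) then ν p.1 * K (g p.1) p.2 else 0),
    Equiv.sum_comp e (fun p => if a p.1 = x then ν p.1 * K (g p.1) p.2 else 0)]
  simp only [Fintype.sum_prod_type]
  rw [Finset.sum_mul]
  refine Finset.sum_congr rfl fun r _ => ?_
  by_cases h : a r = x
  · subst h
    simp [← Finset.mul_sum, hK, hg]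
  · simp [h]

end helpers

set_option linter.unusedSectionVars false

section main_helpers

/-- prefix -/
def bcPre {Ω 𝓨 : Type*} {n : ℕ} (Y : Ω → Fin n → 𝓨) (k : ℕ) (ω : Ω) :
    {j : Fin n // (j : ℕ) < k} → 𝓨 := fun j => Y ω j.1

/-- suffix -/
def bcSuf {Ω 𝓨 : Type*} {n : ℕ} (Y : Ω → Fin n → 𝓨) (k : ℕ) (ω : Ω) :
    {j : Fin n // k ≤ (j : ℕ)} → 𝓨 := fun j => Y ω j.1

variable {Ω 𝓨 𝓨' : Type*} [Fintype Ω] {n : ℕ}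

theorem bcPre_succ (Y : Ω → Fin n → 𝓨) (i : Fin n) (ω ω' : Ω) :
    bcPre Y ((i : ℕ) + 1) ω = bcPre Y ((i : ℕ) + 1) ω' ↔
      (bcPre Y i ω = bcPre Y i ω' ∧ Y ω i = Y ω' i) := by
  simp only [bcPre, funext_iff, Subtype.forall]
  constructor
  · intro h
    exact ⟨fun j hj => h j (by omega), h i (by omega)⟩
  · rintro ⟨h1, h2⟩ j hj
    rcases Nat.lt_succ_iff_lt_or_eq.mp hj with h | h
    · exact h1 j h
    · rw [Fin.ext h]; exact h2

theorem bcSuf_succ (Y : Ω → Fin n → 𝓨) (i : Fin n) (ω ω' : Ω) :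
    bcSuf Y (i : ℕ) ω = bcSuf Y (i : ℕ) ω' ↔
      (bcSuf Y ((i : ℕ) + 1) ω = bcSuf Y ((i : ℕ) + 1) ω' ∧ Y ω i = Y ω' i) := by
  simp only [bcSuf, funext_iff, Subtype.forall]
  constructor
  · intro h
    exact ⟨fun j hj => h j (by omega), h i (by omega)⟩
  · rintro ⟨h1, h2⟩ j hj
    rcases Nat.lt_or_eq_of_le hj with h | h
    · exact h1 j h
    · rw [← Fin.ext h]; exact h2

theorem bcPre_zero (Y : Ω → Fin n → 𝓨) (ω ω' : Ω) : bcPre Y 0 ω = bcPre Y 0 ω' := by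
  funext j; exact absurd j.2 (by omega)

theorem bcSuf_top (Y : Ω → Fin n → 𝓨) (ω ω' : Ω) : bcSuf Y n ω = bcSuf Y n ω' := by
  funext j; exact absurd j.2 (by omega)

theorem bcPre_top (Y : Ω → Fin n → 𝓨) (ω ω' : Ω) :
    bcPre Y n ω = bcPre Y n ω' ↔ Y ω = Y ω' := by
  simp [bcPre, funext_iff]

theorem bcSuf_zero (Y : Ω → Fin n → 𝓨) (ω ω' : Ω) :
    bcSuf Y 0 ω = bcSuf Y 0 ω' ↔ Y ω = Y ω' := by
  simp [bcSuf, funext_iff]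

theorem bc_tel (F : ℕ → ℝ) : ∑ i : Fin n, (F ((i : ℕ) + 1) - F i) = F n - F 0 := by
  rw [Fin.sum_univ_eq_sum_range (fun i => F (i + 1) - F i), Finset.sum_range_sub]

theorem bc_single [Fintype 𝓨] {κ : Type*} [Fintype κ] {υ : Fin n → Type*}
    [∀ i, Fintype (υ i)] {μ : Ω → ℝ} (h0 : ∀ ω, 0 ≤ μ ω) (h1 : ∑ ω, μ ω = 1)
    (W : Ω → κ) (Y : Ω → Fin n → 𝓨) (U : ∀ i, Ω → υ i)
    (hU : ∀ i ω ω', U i ω = U i ω' → W ω = W ω' ∧ bcPre Y i ω = bcPre Y i ω') :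
    bcH μ W + bcH μ Y - bcH μ (fun ω => (W ω, Y ω)) ≤
      ∑ i : Fin n, (bcH μ (U i) + bcH μ (fun ω => Y ω i) - bcH μ (fun ω => (U i ω, Y ω i))) := by
  have t := bc_tel (n := n) (fun k => bcH μ (bcPre Y k) - bcH μ (fun ω => (W ω, bcPre Y k ω)))
  rw [bcH_congr μ (bcPre Y n) Y (bcPre_top Y),
    bcH_congr μ (fun ω => (W ω, bcPre Y n ω)) (fun ω => (W ω, Y ω))
      (by simp [bcPre_top]),
    bcH_congr μ (fun ω => (W ω, bcPre Y 0 ω)) W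
      (fun ω ω' => by simp [bcPre_zero Y ω ω']),
    bcH_const h1 (bcPre Y 0) (bcPre_zero Y)] at t
  have : bcH μ W + bcH μ Y - bcH μ (fun ω => (W ω, Y ω)) = bcH μ Y - bcH μ (fun ω => (W ω, Y ω))
    - (0 - bcH μ W) := by ring
  rw [this, ← t]
  refine Finset.sum_le_sum fun i _ => ?_
  have s1 := bc_subadd h0 h1 (bcPre Y i) (fun ω => Y ω i) (bcPre Y ((i : ℕ) + 1)) (bcPre_succ Y i)
  have s2 := bc_sub h0 h1 (U i) (fun ω => Y ω i) (fun ω => (W ω, bcPre Y i ω))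
    (fun ω => (U i ω, Y ω i)) (U i) (fun ω => (W ω, bcPre Y ((i : ℕ) + 1) ω))
    (fun ω ω' => by have := hU i ω ω'; simp only [Prod.mk.injEq]; tauto)
    (fun ω ω' => by have := hU i ω ω'; simp only [Prod.mk.injEq]; tauto)
    (fun ω ω' => by simp only [Prod.mk.injEq, bcPre_succ]; tauto)
  linarith

theorem bc_third [Fintype 𝓨] [Fintype 𝓨'] {κ κ' : Type*} [Fintype κ] [Fintype κ']
    {υ : Fin n → Type*}
    [∀ i, Fintype (υ i)] {μ : Ω → ℝ} (h0 : ∀ ω, 0 ≤ μ ω) (h1 : ∑ ω, μ ω = 1)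
    (W1 : Ω → κ) (W2 : Ω → κ') (Y1 : Ω → Fin n → 𝓨) (Y2 : Ω → Fin n → 𝓨') (U : ∀ i, Ω → υ i)
    (hU : ∀ i ω ω', U i ω = U i ω' ↔ (W2 ω = W2 ω' ∧
      bcSuf Y1 ((i : ℕ) + 1) ω = bcSuf Y1 ((i : ℕ) + 1) ω' ∧ bcPre Y2 i ω = bcPre Y2 i ω')) :
    bcH μ (fun ω => (W1 ω, W2 ω)) - (bcH μ (fun ω => (W1 ω, W2 ω, Y1 ω))
      - bcH μ (fun ω => (W2 ω, Y1 ω))) - (bcH μ (fun ω => (W2 ω, Y2 ω)) - bcH μ Y2) ≤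
      ∑ i : Fin n, (bcH μ (fun ω => (W1 ω, U i ω)) - bcH μ (fun ω => ((W1 ω, U i ω), Y1 ω i))
        + bcH μ (fun ω => (Y1 ω i, U i ω)) + bcH μ (fun ω => Y2 ω i)
        - bcH μ (fun ω => (U i ω, Y2 ω i))) := by
  have t := bc_tel (n := n) (fun k => bcH μ (bcPre Y2 k)
    + bcH μ (fun ω => (W1 ω, W2 ω, bcSuf Y1 k ω))
    - bcH μ (fun ω => (W2 ω, bcSuf Y1 k ω, bcPre Y2 k ω)))
  rw [bcH_congr μ (bcPre Y2 n) Y2 (bcPre_top Y2),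
    bcH_congr μ (fun ω => (W1 ω, W2 ω, bcSuf Y1 n ω)) (fun ω => (W1 ω, W2 ω))
      (fun ω ω' => by simp [bcSuf_top Y1 ω ω']),
    bcH_congr μ (fun ω => (W2 ω, bcSuf Y1 n ω, bcPre Y2 n ω)) (fun ω => (W2 ω, Y2 ω))
      (fun ω ω' => by simp [bcSuf_top Y1 ω ω', bcPre_top]),
    bcH_congr μ (fun ω => (W1 ω, W2 ω, bcSuf Y1 0 ω)) (fun ω => (W1 ω, W2 ω, Y1 ω))
      (fun ω ω' => by simp [bcSuf_zero]),
    bcH_congr μ (fun ω => (W2 ω, bcSuf Y1 0 ω, bcPre Y2 0 ω)) (fun ω => (W2 ω, Y1 ω))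
      (fun ω ω' => by simp [bcSuf_zero, bcPre_zero Y2 ω ω']),
    bcH_const h1 (bcPre Y2 0) (bcPre_zero Y2)] at t
  refine (le_of_eq ?_).trans (t.symm.le.trans ?_)
  · ring
  refine Finset.sum_le_sum fun i _ => ?_
  have s1 := bc_subadd h0 h1 (bcPre Y2 i) (fun ω => Y2 ω i) (bcPre Y2 ((i : ℕ) + 1))
    (bcPre_succ Y2 i)
  have s2 := bc_sub h0 h1 (fun ω => Y1 ω i) (bcPre Y2 i)
    (fun ω => (W1 ω, W2 ω, bcSuf Y1 ((i : ℕ) + 1) ω))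
    (fun ω => ((W1 ω, U i ω), Y1 ω i)) (fun ω => (W1 ω, W2 ω, bcSuf Y1 (i : ℕ) ω))
    (fun ω => (W1 ω, U i ω))
    (fun ω ω' => by simp only [Prod.mk.injEq, hU]; tauto)
    (fun ω ω' => by simp only [Prod.mk.injEq, bcSuf_succ Y1 i]; tauto)
    (fun ω ω' => by simp only [Prod.mk.injEq, hU]; tauto)
  have e1 : bcH μ (fun ω => (Y1 ω i, U i ω)) =
      bcH μ (fun ω => (W2 ω, bcSuf Y1 (i : ℕ) ω, bcPre Y2 i ω)) :=
    bcH_congr _ _ _ (fun ω ω' => by simp only [Prod.mk.injEq, hU, bcSuf_succ Y1 i]; tauto)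
  have e2 : bcH μ (fun ω => (U i ω, Y2 ω i)) =
      bcH μ (fun ω => (W2 ω, bcSuf Y1 ((i : ℕ) + 1) ω, bcPre Y2 ((i : ℕ) + 1) ω)) :=
    bcH_congr _ _ _ (fun ω ω' => by simp only [Prod.mk.injEq, hU, bcPre_succ Y2 i]; tauto)
  linarith

theorem bc_chanH {α β : Type*} [Fintype α] [DecidableEq α] [Fintype β] [DecidableEq β]
    {μ : Ω → ℝ} (h0 : ∀ ω, 0 ≤ μ ω)
    (A : Ω → α) (B : Ω → β) (k : Ω → ℝ)
    (h : ∀ ω, distOf μ (fun ω => (A ω, B ω)) (A ω, B ω) = distOf μ A (A ω) * k ω) :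
    bcH μ (fun ω => (A ω, B ω)) - bcH μ A = -∑ ω, μ ω * Real.log (k ω) := by
  unfold bcH
  rw [sub_neg_eq_add, ← Finset.sum_neg_distrib, ← Finset.sum_neg_distrib,
    ← Finset.sum_add_distrib]
  refine Finset.sum_congr rfl fun ω _ => ?_
  rcases (h0 ω).eq_or_lt with h' | h'
  · simp [← h']
  have p1 := bcPr_pos h0 A h'
  have p2 := bcPr_pos h0 (fun ω => (A ω, B ω)) h'
  have hh := h ω
  have q1 := bcPr_eq μ A ω
  have q2 := bcPr_eq μ (fun ω => (A ω, B ω)) ω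
  rw [← q1, ← q2] at hh
  have p3 : k ω ≠ 0 := by
    intro h3; rw [h3, mul_zero] at hh; exact p2.ne' hh
  rw [hh, Real.log_mul p1.ne' p3]
  ring

theorem distOf_assoc {α β γ : Type*} [Fintype α] [DecidableEq α] [Fintype β] [DecidableEq β]
    [Fintype γ] [DecidableEq γ] (μ : Ω → ℝ) (A : Ω → α) (B : Ω → β) (C : Ω → γ) (a b c) :
    distOf μ (fun ω => (A ω, B ω, C ω)) (a, b, c) =
      distOf μ (fun ω => ((A ω, B ω), C ω)) ((a, b), c) := by
  simp [distOf, and_assoc]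

theorem distOf_marg3 {α β γ : Type*} [Fintype α] [DecidableEq α] [Fintype β] [DecidableEq β]
    [Fintype γ] [DecidableEq γ] (μ : Ω → ℝ) (A : Ω → α) (B : Ω → β) (C : Ω → γ) (a b) :
    ∑ c, distOf μ (fun ω => (A ω, B ω, C ω)) (a, b, c) =
      distOf μ (fun ω => (A ω, B ω)) (a, b) := by
  rw [← distOf_marg μ C (fun ω => (A ω, B ω))]
  refine Finset.sum_congr rfl fun c _ => ?_
  simp only [distOf, Prod.mk.injEq]
  refine Finset.sum_congr ?_ fun _ _ => rfl
  ext x; simp; tauto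

/-- split off coordinate `i` -/
def bcSplit (κ κ' 𝓨 𝓨' : Type*) (i : Fin n) :
    (κ × κ' × (Fin n → 𝓨) × (Fin n → 𝓨')) ≃
      (κ × κ' × ({j : Fin n // j ≠ i} → 𝓨) × ({j : Fin n // j ≠ i} → 𝓨')) × (𝓨 × 𝓨') where
  toFun ω := ((ω.1, ω.2.1, fun j => ω.2.2.1 j.1, fun j => ω.2.2.2 j.1), (ω.2.2.1 i, ω.2.2.2 i))
  invFun p := (p.1.1, p.1.2.1, fun j => if h : j = i then p.2.1 else p.1.2.2.1 ⟨j, h⟩,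
    fun j => if h : j = i then p.2.2 else p.1.2.2.2 ⟨j, h⟩)
  left_inv := by
    rintro ⟨w1, w2, y1, y2⟩
    simp only [Prod.mk.injEq, true_and]
    constructor <;> funext j <;> by_cases h : j = i <;> simp [h]
  right_inv := by
    rintro ⟨⟨w1, w2, y1, y2⟩, z1, z2⟩
    simp only [Prod.mk.injEq, true_and, dite_true, and_true]
    constructor <;> funext j <;> simp [j.2]

theorem bc_total {𝓧 𝓨1 𝓨2 : Type*} [Fintype 𝓨1] [Fintype 𝓨2]
    (P : 𝓧 → 𝓨1 → 𝓨2 → ℝ) (hPsum : ∀ x, ∑ y1, ∑ y2, P x y1 y2 = 1) (x : Fin n → 𝓧) :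
    ∑ y1 : Fin n → 𝓨1, ∑ y2 : Fin n → 𝓨2, ∏ i, P (x i) (y1 i) (y2 i) = 1 := by
  rw [← Fintype.sum_prod_type' (f := fun (y1 : Fin n → 𝓨1) (y2 : Fin n → 𝓨2) =>
    ∏ i, P (x i) (y1 i) (y2 i)),
    ← Equiv.sum_comp (Equiv.arrowProdEquivProdArrow (Fin n) (fun _ => 𝓨1) (fun _ => 𝓨2))]
  have := Finset.prod_univ_sum (fun _ : Fin n => (univ : Finset (𝓨1 × 𝓨2)))
    (fun i p => P (x i) p.1 p.2)
  simp only [Fintype.sum_prod_type, hPsum, Finset.prod_const_one, Fintype.piFinset_univ] at this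
  rw [this]
  rfl

end main_helpers

/-- El Gamal's converse bounds for two-receiver broadcast channels:
for any `(n, M₁, M₂, ε)`-code (encoder `f`, decoders `φ₁, φ₂`, average error `≤ ε`)
over the discrete memoryless broadcast channel `P_{Y₁Y₂|X}`, the auxiliary random
variables `U₁ᵢ = (W₁, Y₁^{i−1}, Y₂^{i+1..n})` and `U₂ᵢ = (W₂, Y₁^{i+1..n}, Y₂^{i−1})`
satisfy the Markov chains `(U₁ᵢ, U₂ᵢ) → Xᵢ → (Y₁ᵢ, Y₂ᵢ)` and the three converse
inequalities. -/
theorem stmt19 {𝓧 𝓨1 𝓨2 : Type*} [Fintype 𝓧] [Fintype 𝓨1] [Fintype 𝓨2]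
    [DecidableEq 𝓧] [DecidableEq 𝓨1] [DecidableEq 𝓨2]
    (n M1 M2 : ℕ) (hn : 0 < n) (hM1 : 0 < M1) (hM2 : 0 < M2) (ε : ℝ) (hε : ε ∈ Set.Ico (0:ℝ) 1)
    (P : 𝓧 → 𝓨1 → 𝓨2 → ℝ)
    (hPnn : ∀ x y1 y2, 0 ≤ P x y1 y2) (hPsum : ∀ x, ∑ y1, ∑ y2, P x y1 y2 = 1)
    (f : Fin M1 → Fin M2 → Fin n → 𝓧)
    (φ1 : (Fin n → 𝓨1) → Fin M1) (φ2 : (Fin n → 𝓨2) → Fin M2)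
    (μ : Fin M1 × Fin M2 × (Fin n → 𝓨1) × (Fin n → 𝓨2) → ℝ)
    (hμ : ∀ w1 w2 y1 y2, μ (w1, w2, y1, y2) =
      (1 / ((M1 : ℝ) * (M2 : ℝ))) * ∏ i, P (f w1 w2 i) (y1 i) (y2 i))
    (herr : (∑ ω ∈ univ.filter
        (fun ω : Fin M1 × Fin M2 × (Fin n → 𝓨1) × (Fin n → 𝓨2) =>
          φ1 ω.2.2.1 ≠ ω.1 ∨ φ2 ω.2.2.2 ≠ ω.2.1), μ ω) ≤ ε)
    -- the auxiliary random variables `U₁ᵢ := (W₁, Y₁^{i−1}, Y_{2,i+1}^n)`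
    (U1 : (i : Fin n) → Fin M1 × Fin M2 × (Fin n → 𝓨1) × (Fin n → 𝓨2) →
      Fin M1 × ({j : Fin n // (j : ℕ) < (i : ℕ)} → 𝓨1) ×
        ({j : Fin n // (i : ℕ) < (j : ℕ)} → 𝓨2))
    (hU1 : ∀ i ω, U1 i ω = (ω.1, fun j => ω.2.2.1 j.1, fun j => ω.2.2.2 j.1))
    -- and `U₂ᵢ := (W₂, Y_{1,i+1}^n, Y₂^{i−1})`
    (U2 : (i : Fin n) → Fin M1 × Fin M2 × (Fin n → 𝓨1) × (Fin n → 𝓨2) →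
      Fin M2 × ({j : Fin n // (i : ℕ) < (j : ℕ)} → 𝓨1) ×
        ({j : Fin n // (j : ℕ) < (i : ℕ)} → 𝓨2))
    (hU2 : ∀ i ω, U2 i ω = (ω.2.1, fun j => ω.2.2.1 j.1, fun j => ω.2.2.2 j.1)) :
    -- Markov chain `(U₁ᵢ, U₂ᵢ) → Xᵢ → (Y₁ᵢ, Y₂ᵢ)`
    (∀ i : Fin n, ∀ u, ∀ x : 𝓧, ∀ y : 𝓨1 × 𝓨2,
      distOf μ (fun ω => ((U1 i ω, U2 i ω), f ω.1 ω.2.1 i, (ω.2.2.1 i, ω.2.2.2 i)))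
          (u, x, y) *
        distOf μ (fun ω => f ω.1 ω.2.1 i) x =
      distOf μ (fun ω => ((U1 i ω, U2 i ω), f ω.1 ω.2.1 i)) (u, x) *
        distOf μ (fun ω => (f ω.1 ω.2.1 i, (ω.2.2.1 i, ω.2.2.2 i))) (x, y)) ∧
    Real.log M1 * (1 - ε) - 1 ≤
      ∑ i : Fin n, MI μ (U1 i) (fun ω => ω.2.2.1 i) ∧
    Real.log M2 * (1 - ε) - 1 ≤
      ∑ i : Fin n, MI μ (U2 i) (fun ω => ω.2.2.2 i) ∧
    (Real.log M1 + Real.log M2) * (1 - ε) - 2 ≤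
      ∑ i : Fin n, (CMI μ (fun ω => f ω.1 ω.2.1 i) (fun ω => ω.2.2.1 i) (U2 i) +
        MI μ (U2 i) (fun ω => ω.2.2.2 i)) := by
  obtain rfl : U1 = fun i ω => (ω.1, fun j => ω.2.2.1 j.1, fun j => ω.2.2.2 j.1) := by
    funext i ω; exact hU1 i ω
  obtain rfl : U2 = fun i ω => (ω.2.1, fun j => ω.2.2.1 j.1, fun j => ω.2.2.2 j.1) := by
    funext i ω; exact hU2 i ω
  clear hU1 hU2
  have hM1' : (0:ℝ) < M1 := by exact_mod_cast hM1
  have hM2' : (0:ℝ) < M2 := by exact_mod_cast hM2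
  have : Nonempty (Fin M1) := ⟨⟨0, hM1⟩⟩
  have : Nonempty (Fin M2) := ⟨⟨0, hM2⟩⟩
  have h0 : ∀ ω, 0 ≤ μ ω := by
    rintro ⟨w1, w2, y1, y2⟩
    rw [hμ]
    exact mul_nonneg (by positivity) (Finset.prod_nonneg fun i _ => hPnn _ _ _)
  have hw12 : ∀ w1 w2, ∑ y1, ∑ y2, μ (w1, w2, y1, y2) = 1 / ((M1 : ℝ) * (M2 : ℝ)) := by
    intro w1 w2
    simp only [hμ, ← Finset.mul_sum]
    rw [bc_total P hPsum (f w1 w2), mul_one]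
  have h1 : ∑ ω, μ ω = 1 := by
    simp only [Fintype.sum_prod_type, hw12, Finset.sum_const, Finset.card_univ, Fintype.card_fin,
      nsmul_eq_mul]
    field_simp
  have hd12 : ∀ p, distOf μ (fun ω => (ω.1, ω.2.1)) p = 1 / ((M1 : ℝ) * (M2 : ℝ)) := by
    rintro ⟨w1, w2⟩
    rw [← hw12 w1 w2]
    unfold distOf
    rw [Finset.sum_filter]
    simp only [Fintype.sum_prod_type, Prod.mk.injEq]
    rw [Finset.sum_eq_single w1 (fun b _ hb => by simp [hb]) (by simp),
      Finset.sum_eq_single w2 (fun b _ hb => by simp [hb]) (by simp)]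
    simp
  have hH12 : bcH μ (fun ω => (ω.1, ω.2.1)) = Real.log M1 + Real.log M2 := by
    rw [bc_unif h1 _ (fun a => by rw [hd12]; simp), ← Real.log_mul hM1'.ne' hM2'.ne']
    simp
  have hH1 : bcH μ (fun ω => ω.1) = Real.log M1 := by
    rw [bc_unif h1 _ (fun a => ?_)]
    · simp
    · have : distOf μ (fun ω => ω.1) a = ∑ b, distOf μ (fun ω => (ω.2.1, ω.1)) (b, a) :=
        (distOf_marg _ _ _ _).symm
      rw [this]
      have : ∀ b, distOf μ (fun ω => (ω.2.1, ω.1)) (b, a) =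
          distOf μ (fun ω => (ω.1, ω.2.1)) (a, b) := fun b => by
        simp [distOf, and_comm]
      simp only [this, hd12, Finset.sum_const, Finset.card_univ, Fintype.card_fin, nsmul_eq_mul]
      field_simp
  have hH2 : bcH μ (fun ω => ω.2.1) = Real.log M2 := by
    rw [bc_unif h1 _ (fun a => ?_)]
    · simp
    · have : distOf μ (fun ω => ω.2.1) a = ∑ b, distOf μ (fun ω => (ω.1, ω.2.1)) (b, a) :=
        (distOf_marg _ _ _ _).symm
      rw [this]
      simp only [hd12, Finset.sum_const, Finset.card_univ, Fintype.card_fin, nsmul_eq_mul]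
      field_simp
  have hK : ∀ x, ∑ y : 𝓨1 × 𝓨2, P x y.1 y.2 = 1 := fun x => by
    rw [Fintype.sum_prod_type, hPsum]
  have hfac' : ∀ i : Fin n, ∃ ν : Fin M1 × Fin M2 × ({j : Fin n // j ≠ i} → 𝓨1) ×
      ({j : Fin n // j ≠ i} → 𝓨2) → ℝ, ∀ ω, μ ω = ν (bcSplit (Fin M1) (Fin M2) 𝓨1 𝓨2 i ω).1 *
      (fun x (y : 𝓨1 × 𝓨2) => P x y.1 y.2)
        ((fun r : Fin M1 × Fin M2 × ({j : Fin n // j ≠ i} → 𝓨1) ×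
      ({j : Fin n // j ≠ i} → 𝓨2) => f r.1 r.2.1 i) (bcSplit (Fin M1) (Fin M2) 𝓨1 𝓨2 i ω).1)
        (bcSplit (Fin M1) (Fin M2) 𝓨1 𝓨2 i ω).2 := by
    intro i
    refine ⟨fun r => (1 / ((M1 : ℝ) * (M2 : ℝ))) *
        ∏ j, P (f r.1 r.2.1 j.1) (r.2.2.1 j) (r.2.2.2 j), ?_⟩
    rintro ⟨w1, w2, y1, y2⟩
    rw [hμ, Fintype.prod_eq_mul_prod_subtype_ne _ i]
    simp only [bcSplit, Equiv.coe_fn_mk]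
    ring
  choose ν hfac using hfac'
  have er1 : ∑ ω ∈ univ.filter (fun ω : Fin M1 × Fin M2 × (Fin n → 𝓨1) × (Fin n → 𝓨2) =>
      φ1 ω.2.2.1 ≠ ω.1), μ ω ≤ ε := by
    refine le_trans (Finset.sum_le_sum_of_subset_of_nonneg ?_ fun _ _ _ => h0 _) herr
    intro ω; simp only [Finset.mem_filter]; tauto
  have er2 : ∑ ω ∈ univ.filter (fun ω : Fin M1 × Fin M2 × (Fin n → 𝓨1) × (Fin n → 𝓨2) =>
      φ2 ω.2.2.2 ≠ ω.2.1), μ ω ≤ ε := by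
    refine le_trans (Finset.sum_le_sum_of_subset_of_nonneg ?_ fun _ _ _ => h0 _) herr
    intro ω; simp only [Finset.mem_filter]; tauto
  have F1 := bc_fano hM1 h0 h1 (fun ω => ω.1) (fun ω => ω.2.2.1) φ1 ε er1
  have F2 := bc_fano hM2 h0 h1 (fun ω => ω.2.1) (fun ω => ω.2.2.2) φ2 ε er2
  refine ⟨?_, ?_, ?_, ?_⟩
  · rintro i u x y
    rw [distOf_assoc]
    have q1 := bc_chan (bcSplit (Fin M1) (Fin M2) 𝓨1 𝓨2 i) μ (ν i)
      (fun x (y : 𝓨1 × 𝓨2) => P x y.1 y.2) hK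
      (fun r => f r.1 r.2.1 i) (hfac i)
      (fun ω => ((
        ((ω.1, (fun j => ω.2.2.1 j.1 : {j : Fin n // (j : ℕ) < (i : ℕ)} → 𝓨1),
          (fun j => ω.2.2.2 j.1 : {j : Fin n // (i : ℕ) < (j : ℕ)} → 𝓨2)),
        (ω.2.1, (fun j => ω.2.2.1 j.1 : {j : Fin n // (i : ℕ) < (j : ℕ)} → 𝓨1),
          (fun j => ω.2.2.2 j.1 : {j : Fin n // (j : ℕ) < (i : ℕ)} → 𝓨2))), f ω.1 ω.2.1 i)))
      (fun r => (((r.1, fun j => r.2.2.1 ⟨j.1, fun h => by have := j.2; simp [h] at this⟩,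
          fun j => r.2.2.2 ⟨j.1, fun h => by have := j.2; simp [h] at this⟩),
        (r.2.1, fun j => r.2.2.1 ⟨j.1, fun h => by have := j.2; simp [h] at this⟩,
          fun j => r.2.2.2 ⟨j.1, fun h => by have := j.2; simp [h] at this⟩)), f r.1 r.2.1 i))
      (fun ω => rfl) (fun a => a.2) (fun r => rfl) (fun ω => (ω.2.2.1 i, ω.2.2.2 i))
      (fun ω => rfl) (u, x) y
    have q2 := bc_chan (bcSplit (Fin M1) (Fin M2) 𝓨1 𝓨2 i) μ (ν i)
      (fun x (y : 𝓨1 × 𝓨2) => P x y.1 y.2) hK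
      (fun r => f r.1 r.2.1 i) (hfac i) (fun ω => f ω.1 ω.2.1 i)
      (fun r => f r.1 r.2.1 i)
      (fun ω => rfl) (fun a => a) (fun r => rfl) (fun ω => (ω.2.2.1 i, ω.2.2.2 i))
      (fun ω => rfl) x y
    dsimp only at q1 q2 ⊢
    rw [q1, q2]
    ring
  · simp only [MI_eq h0]
    refine le_trans ?_ (bc_single h0 h1 (fun ω => ω.1) (fun ω => ω.2.2.1) _ ?_)
    · rw [hH1]; linarith
    · intro i ω ω' h
      simp only [Prod.mk.injEq] at h
      exact ⟨h.1, h.2.1⟩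
  · simp only [MI_eq h0]
    refine le_trans ?_ (bc_single h0 h1 (fun ω => ω.2.1) (fun ω => ω.2.2.2) _ ?_)
    · rw [hH2]; linarith
    · intro i ω ω' h
      simp only [Prod.mk.injEq] at h
      exact ⟨h.1, h.2.2⟩
  · simp only [MI_eq h0, CMI_eq h0]
    have T := bc_third h0 h1 (fun ω => ω.1) (fun ω => ω.2.1) (fun ω => ω.2.2.1)
      (fun ω => ω.2.2.2) (fun (i : Fin n)
        (ω : Fin M1 × Fin M2 × (Fin n → 𝓨1) × (Fin n → 𝓨2)) => ((ω.2.1,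
        (fun j => ω.2.2.1 j.1 : {j : Fin n // (i : ℕ) < (j : ℕ)} → 𝓨1),
        (fun j => ω.2.2.2 j.1 : {j : Fin n // (j : ℕ) < (i : ℕ)} → 𝓨2))))
      (fun i ω ω' => by simp only [Prod.mk.injEq]; exact Iff.rfl)
    rw [hH12] at T
    have S := bc_sub h0 h1 (fun ω => ω.1) (fun ω => ω.2.1) (fun ω => ω.2.2.1)
      (fun ω => (ω.1, ω.2.1, ω.2.2.1)) (fun ω => (ω.1, ω.2.2.1)) (fun ω => (ω.2.1, ω.2.2.1))
      (by simp) (by simp) (by simp)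
    refine le_trans (by linarith) (T.trans (Finset.sum_le_sum fun i _ => ?_))
    have c1 := bc_chanH h0 (fun ω => (ω.1, (ω.2.1,
        (fun j => ω.2.2.1 j.1 : {j : Fin n // (i : ℕ) < (j : ℕ)} → 𝓨1),
        (fun j => ω.2.2.2 j.1 : {j : Fin n // (j : ℕ) < (i : ℕ)} → 𝓨2)))) (fun ω => ω.2.2.1 i)
      (fun ω => ∑ y2, P (f ω.1 ω.2.1 i) (ω.2.2.1 i) y2) (fun ω => by
        rw [← distOf_marg3 μ _ _ (fun ω => ω.2.2.2 i), Finset.mul_sum]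
        refine Finset.sum_congr rfl fun c _ => ?_
        exact bc_chan (bcSplit (Fin M1) (Fin M2) 𝓨1 𝓨2 i) μ (ν i)
          (fun x (y : 𝓨1 × 𝓨2) => P x y.1 y.2) hK
          (fun r => f r.1 r.2.1 i) (hfac i) _
          (fun r => (r.1,
            (r.2.1, (fun j : {j : Fin n // (i : ℕ) < (j : ℕ)} =>
                r.2.2.1 ⟨j.1, fun h => by have := j.2; simp [h] at this⟩),
              (fun j : {j : Fin n // (j : ℕ) < (i : ℕ)} =>
                r.2.2.2 ⟨j.1, fun h => by have := j.2; simp [h] at this⟩))))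
          (fun ω => rfl) (fun a => f a.1 a.2.1 i) (fun r => rfl) (fun ω => (ω.2.2.1 i, ω.2.2.2 i))
          (fun ω => rfl) _ (ω.2.2.1 i, c))
    have c2 := bc_chanH h0 (fun ω => (f ω.1 ω.2.1 i, (ω.2.1,
        (fun j => ω.2.2.1 j.1 : {j : Fin n // (i : ℕ) < (j : ℕ)} → 𝓨1),
        (fun j => ω.2.2.2 j.1 : {j : Fin n // (j : ℕ) < (i : ℕ)} → 𝓨2)))) (fun ω => ω.2.2.1 i)
      (fun ω => ∑ y2, P (f ω.1 ω.2.1 i) (ω.2.2.1 i) y2) (fun ω => by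
        rw [← distOf_marg3 μ _ _ (fun ω => ω.2.2.2 i), Finset.mul_sum]
        refine Finset.sum_congr rfl fun c _ => ?_
        exact bc_chan (bcSplit (Fin M1) (Fin M2) 𝓨1 𝓨2 i) μ (ν i)
          (fun x (y : 𝓨1 × 𝓨2) => P x y.1 y.2) hK
          (fun r => f r.1 r.2.1 i) (hfac i) _
          (fun r => (f r.1 r.2.1 i,
            (r.2.1, (fun j : {j : Fin n // (i : ℕ) < (j : ℕ)} =>
                r.2.2.1 ⟨j.1, fun h => by have := j.2; simp [h] at this⟩),
              (fun j : {j : Fin n // (j : ℕ) < (i : ℕ)} =>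
                r.2.2.2 ⟨j.1, fun h => by have := j.2; simp [h] at this⟩))))
          (fun ω => rfl) (fun a => a.1) (fun r => rfl) (fun ω => (ω.2.2.1 i, ω.2.2.2 i))
          (fun ω => rfl) _ (ω.2.2.1 i, c))
    have c3 : bcH μ (fun ω => (f ω.1 ω.2.1 i, ω.2.2.1 i, (ω.2.1,
        (fun j => ω.2.2.1 j.1 : {j : Fin n // (i : ℕ) < (j : ℕ)} → 𝓨1),
        (fun j => ω.2.2.2 j.1 : {j : Fin n // (j : ℕ) < (i : ℕ)} → 𝓨2)))) =
      bcH μ (fun ω => ((f ω.1 ω.2.1 i, (ω.2.1,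
        (fun j => ω.2.2.1 j.1 : {j : Fin n // (i : ℕ) < (j : ℕ)} → 𝓨1),
        (fun j => ω.2.2.2 j.1 : {j : Fin n // (j : ℕ) < (i : ℕ)} → 𝓨2))), ω.2.2.1 i)) :=
      bcH_congr _ _ _ (fun ω ω' => by simp only [Prod.mk.injEq]; tauto)
    linarith
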